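/- Let H be a complex Hilbert space with an orthogonal decomposition H = H_L ⊕ H_C ⊕ H_R, and let U = A ∘ B be an H_C-overlapping factorization of a unitary operator U on H. Then for every z ∈ ℂ with |z| < 1 the operators U − z·(1 − P_C), A − z·(P_LC − P_C) and B − z·(P_CR − P_C) are invertible in B(H), and P_C ∘ (U − z·(1 − P_C))^{-1} ∘ P_C = (P_C ∘ (B − z·(P_CR − P_C))^{-1} ∘ P_C) ∘ (P_C ∘ (A − z·(P_LC − P_C))^{-1} ∘ P_C). (The U-Schur function of the overlapping subspace H_C factorizes as f_{H_C} = f^R_{H_C} · f^L_{H_C}.) -/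

import Mathlib

/-- An `H_C`-overlapping factorization of a unitary `U` relative to the orthogonal
decomposition `H = H_L ⊕ H_C ⊕ H_R` (encoded by the orthogonal projections
`PL, PC, PR`): unitaries `A, B` with `U = A ∘ B`, `A` fixing `H_R` pointwise and mapping
`H_LC = H_L ⊕ H_C` into itself, and `B` fixing `H_L` pointwise and mapping
`H_CR = H_C ⊕ H_R` into itself. -/
def IsOverlapFac {H : Type*} [NormedAddCommGroup H] [InnerProductSpace ℂ H]
    [CompleteSpace H] (PL PC PR U A B : H →L[ℂ] H) : Prop :=
  A ∈ unitary (H →L[ℂ] H) ∧ B ∈ unitary (H →L[ℂ] H) ∧ U = A * B ∧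
  A * PR = PR ∧ (PL + PC) * (A * (PL + PC)) = A * (PL + PC) ∧
  B * PL = PL ∧ (PC + PR) * (B * (PC + PR)) = B * (PC + PR)

theorem aux_norm_le_one {H : Type*} [NormedAddCommGroup H] [InnerProductSpace ℂ H]
    [CompleteSpace H] (P : H →L[ℂ] H) (hs : IsSelfAdjoint P) (hi : P * P = P) : ‖P‖ ≤ 1 := by
  have h := CStarRing.norm_star_mul_self (x := P)
  rw [hs.star_eq, hi] at h
  by_contra hc
  nlinarith [norm_nonneg P]

theorem aux_isUnit {H : Type*} [NormedAddCommGroup H] [InnerProductSpace ℂ H]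
    [CompleteSpace H] (A P : H →L[ℂ] H) (hA : A ∈ unitary (H →L[ℂ] H))
    (hs : IsSelfAdjoint P) (hi : P * P = P) (z : ℂ) (hz : ‖z‖ < 1) :
    IsUnit (A - z • P) := by
  have h1 : A - z • P = A * (1 - z • (star A * P)) := by
    rw [mul_sub, mul_smul_comm, ← mul_assoc, (Unitary.mem_iff.mp hA).2, one_mul, mul_one]
  have hAu : IsUnit A :=
    ⟨⟨A, star A, (Unitary.mem_iff.mp hA).2, (Unitary.mem_iff.mp hA).1⟩, rfl⟩
  rw [h1]
  refine hAu.mul (isUnit_one_sub_of_norm_lt_one ?_)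
  have hP := aux_norm_le_one P hs hi
  have h2 : ‖star A * P‖ = ‖P‖ :=
    CStarRing.norm_mem_unitary_mul P (Unitary.star_mem hA)
  rw [norm_smul, h2]
  nlinarith [norm_nonneg z, norm_nonneg P]

theorem aux_left {H : Type*} [NormedAddCommGroup H] [InnerProductSpace ℂ H]
    [CompleteSpace H] (A P : H →L[ℂ] H) (hA : A ∈ unitary (H →L[ℂ] H))
    (hs : IsSelfAdjoint P) (h : A * P = P) : P * A = P := by
  have h1 : star A * P = P := by
    conv_lhs => rw [← h, ← mul_assoc, (Unitary.mem_iff.mp hA).1, one_mul]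
  have h2 := congrArg star h1
  rwa [star_mul, star_star, hs.star_eq] at h2

theorem aux_comm {R : Type*} [Ring R] {M P : R} (hM : IsUnit M) (h : M * P = P * M) :
    Ring.inverse M * P = P * Ring.inverse M := by
  calc Ring.inverse M * P = Ring.inverse M * (P * M) * Ring.inverse M := by
        rw [mul_assoc, mul_assoc, Ring.mul_inverse_cancel _ hM, mul_one]
    _ = P * Ring.inverse M := by
        rw [← h, ← mul_assoc, Ring.inverse_mul_cancel _ hM, one_mul]

/-- (Khrushchev's formula for the overlapping subspace.)  For an
`H_C`-overlapping factorization `U = A ∘ B` and `|z| < 1`, the relevant operators are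
invertible and the `U`-Schur function of `H_C` factorizes as `f_{H_C} = f^R_{H_C} f^L_{H_C}`:
`P_C (U − z(1−P_C))⁻¹ P_C =
  (P_C (B − z(P_CR − P_C))⁻¹ P_C) ∘ (P_C (A − z(P_LC − P_C))⁻¹ P_C)`. -/
theorem statement12 {H : Type*} [NormedAddCommGroup H] [InnerProductSpace ℂ H]
    [CompleteSpace H] (PL PC PR : H →L[ℂ] H)
    (hPLsa : IsSelfAdjoint PL) (hPLi : PL * PL = PL)
    (hPCsa : IsSelfAdjoint PC) (hPCi : PC * PC = PC)
    (hPRsa : IsSelfAdjoint PR) (hPRi : PR * PR = PR)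
    (hsum : PL + PC + PR = 1)
    (hLC : PL * PC = 0) (hLR : PL * PR = 0) (hCR : PC * PR = 0)
    (U A B : H →L[ℂ] H) (hU : U ∈ unitary (H →L[ℂ] H))
    (hfac : IsOverlapFac PL PC PR U A B)
    (z : ℂ) (hz : ‖z‖ < 1) :
    IsUnit (U - z • ((1 : H →L[ℂ] H) - PC)) ∧
    IsUnit (A - z • ((PL + PC) - PC)) ∧
    IsUnit (B - z • ((PC + PR) - PC)) ∧
    PC * Ring.inverse (U - z • ((1 : H →L[ℂ] H) - PC)) * PC =
      (PC * Ring.inverse (B - z • ((PC + PR) - PC)) * PC) *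
        (PC * Ring.inverse (A - z • ((PL + PC) - PC)) * PC) := by
  obtain ⟨hA, hB, hUAB, hAR, -, hBL, -⟩ := hfac
  have hRA := aux_left A PR hA hPRsa hAR
  have hLB := aux_left B PL hB hPLsa hBL
  have hRL : PR * PL = 0 := by
    have := congrArg star hLR
    rwa [star_mul, hPRsa.star_eq, hPLsa.star_eq, star_zero] at this
  have hRC : PR * PC = 0 := by
    have := congrArg star hCR
    rwa [star_mul, hPRsa.star_eq, hPCsa.star_eq, star_zero] at this
  have hCL : PC * PL = 0 := by
    have := congrArg star hLC
    rwa [star_mul, hPLsa.star_eq, hPCsa.star_eq, star_zero] at this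
  have e1 : PL + PC - PC = PL := add_sub_cancel_right _ _
  have e2 : PC + PR - PC = PR := add_sub_cancel_left _ _
  have e3 : (1 : H →L[ℂ] H) - PC = PL + PR := by rw [← hsum, sub_eq_iff_eq_add]; exact add_right_comm _ _ _
  rw [e1, e2, e3]
  have hM := aux_isUnit A PL hA hPLsa hPLi z hz
  have hN := aux_isUnit B PR hB hPRsa hPRi z hz
  have hprod : U - z • (PL + PR) = (A - z • PL) * (B - z • PR) := by
    simp only [mul_sub, sub_mul, smul_mul_assoc, mul_smul_comm, hAR, hLB, hLR, hUAB, smul_zero,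
      smul_add, sub_zero]
    rw [sub_sub, add_comm]
  have cM := aux_comm (P := PR) hM (by
    simp only [mul_sub, sub_mul, smul_mul_assoc, mul_smul_comm, hAR, hRA, hLR, hRL])
  have cN := aux_comm (P := PL) hN (by
    simp only [mul_sub, sub_mul, smul_mul_assoc, mul_smul_comm, hBL, hLB, hLR, hRL])
  have hinv : Ring.inverse (U - z • (PL + PR)) =
      Ring.inverse (B - z • PR) * Ring.inverse (A - z • PL) := by
    rw [hprod]
    exact Ring.inverse_mul (Or.inl hM)
  refine ⟨hprod ▸ hM.mul hN, hM, hN, ?_⟩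
  rw [hinv]
  generalize Ring.inverse (A - z • PL) = X at *
  generalize Ring.inverse (B - z • PR) = Y at *
  have k1 : PC * Y * PL = 0 := by rw [mul_assoc, cN, ← mul_assoc, hCL, zero_mul]
  have k2 : PR * X * PC = 0 := by rw [← cM, mul_assoc, hRC, mul_zero]
  calc PC * (Y * X) * PC = PC * Y * (PL + PC + PR) * X * PC := by
        rw [hsum]; simp only [mul_assoc, one_mul]
    _ = PC * Y * PL * X * PC + PC * Y * PC * X * PC + PC * Y * (PR * X * PC) := by
        simp only [mul_add, add_mul, mul_assoc]
    _ = PC * Y * (PC * PC) * X * PC := by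
        rw [k1, k2, hPCi]; simp
    _ = _ := by simp only [mul_assoc]
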